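/- arXiv:2302.06585 — 5 statements merged into one kernel-verified Lean document; each statement's English description precedes it below -/
import Mathlib

section
/- Let n ≥ 2, and let ω be a constant invertible symmetric real n×n matrix (for example the Minkowski metric) with inverse entries ω^{ij}. For all smooth compactly supported maps Ω, λ from ℝⁿ to the symmetric real n×n matrices, one has ∫_{ℝⁿ} Σ_{i,j,k,l} ω^{ik} ω^{jl} λ_{kl}(x) · E(Ω)_{ij}(x) dx = ∫_{ℝⁿ} Σ_{i,j,k,l} ω^{ik} ω^{jl} Ω_{kl}(x) · E(λ)_{ij}(x) dx; that is, the linearized Einstein operator is formally self-adjoint with respect to the bilinear pairing ⟨A,B⟩_ω = Σ ω^{ik}ω^{jl}A_{ij}B_{kl}. -/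
open MeasureTheory

/-- Partial derivative in the `i`-th coordinate direction of `ℝⁿ = Fin n → ℝ`. -/
noncomputable def pd {n : ℕ} (i : Fin n) (f : (Fin n → ℝ) → ℝ) : (Fin n → ℝ) → ℝ :=
  fun x => fderiv ℝ f x (Pi.single i 1)

/-- Second partial derivative `∂_i ∂_j`. -/
noncomputable def pd2 {n : ℕ} (i j : Fin n) (f : (Fin n → ℝ) → ℝ) : (Fin n → ℝ) → ℝ :=
  pd i (pd j f)

/-- The linearized Einstein operator over a constant metric `ω` with inverse `ωinv`:
`2·E(Ω)_{ij} = Σ ω^{rs} ∂_r∂_s Ω_{ij} + ∂_i∂_j(tr_ω Ω) − Σ ω^{rs}(∂_r∂_i Ω_{sj} + ∂_r∂_j Ω_{si})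
  − ω_{ij}·(Σ ω^{rs} ∂_r∂_s (tr_ω Ω) − Σ ω^{ru} ω^{sv} ∂_r∂_s Ω_{uv})`. -/
noncomputable def einsteinOp {n : ℕ} (ω ωinv : Matrix (Fin n) (Fin n) ℝ)
    (Ω : (Fin n → ℝ) → Fin n → Fin n → ℝ) (i j : Fin n) : (Fin n → ℝ) → ℝ :=
  fun x =>
    (1 / 2) * ((∑ r, ∑ s, ωinv r s * pd2 r s (fun y => Ω y i j) x)
      + pd2 i j (fun y => ∑ r, ∑ s, ωinv r s * Ω y r s) x
      - (∑ r, ∑ s, ωinv r s * (pd2 r i (fun y => Ω y s j) x + pd2 r j (fun y => Ω y s i) x))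
      - ω i j * ((∑ r, ∑ s, ωinv r s * pd2 r s (fun y => ∑ u, ∑ v, ωinv u v * Ω y u v) x)
        - ∑ r, ∑ u, ∑ s, ∑ v, ωinv r u * ωinv s v * pd2 r s (fun y => Ω y u v) x))

section PartialDerivatives

variable {n : ℕ} {f g : (Fin n → ℝ) → ℝ}

lemma pd_contDiff (i : Fin n) (hf : ContDiff ℝ (⊤ : ℕ∞) f) : ContDiff ℝ (⊤ : ℕ∞) (pd i f) :=
  (hf.fderiv_right (m := (⊤ : ℕ∞)) (by simp)).clm_apply contDiff_const

lemma pd_hasCompactSupport (i : Fin n) (hf : HasCompactSupport f) :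
    HasCompactSupport (pd i f) :=
  hf.fderiv_apply ℝ _

lemma pd2_contDiff (i j : Fin n) (hf : ContDiff ℝ (⊤ : ℕ∞) f) :
    ContDiff ℝ (⊤ : ℕ∞) (pd2 i j f) :=
  pd_contDiff i (pd_contDiff j hf)

lemma pd2_comm (i j : Fin n) (hf : ContDiff ℝ (⊤ : ℕ∞) f) : pd2 i j f = pd2 j i f := by
  funext x
  have hd : DifferentiableAt ℝ (fderiv ℝ f) x :=
    ((hf.fderiv_right (m := (⊤ : ℕ∞)) (by simp)).differentiable (by simp)).differentiableAt
  have expand (a b : Fin n) :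
      pd2 a b f x = fderiv ℝ (fderiv ℝ f) x (Pi.single a 1) (Pi.single b 1) := by
    change fderiv ℝ (fun y => fderiv ℝ f y (Pi.single b 1)) x (Pi.single a 1) = _
    rw [fderiv_clm_apply hd (differentiableAt_const _)]
    simp
  rw [expand, expand]
  have hf₂ : ContDiff ℝ 2 f := hf.of_le (WithTop.coe_le_coe.2 le_top)
  exact (hf₂.contDiffAt.isSymmSndFDerivAt (by simp)) _ _

lemma pd_sum {ι : Type*} (s : Finset ι) (c : ι → ℝ) (F : ι → (Fin n → ℝ) → ℝ)
    (hF : ∀ t, ContDiff ℝ (⊤ : ℕ∞) (F t)) (i : Fin n) :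
    pd i (fun y => ∑ t ∈ s, c t * F t y) = fun y => ∑ t ∈ s, c t * pd i (F t) y := by
  funext x
  have hd (t : ι) : DifferentiableAt ℝ (F t) x :=
    ((hF t).differentiable (by simp)).differentiableAt
  unfold pd
  rw [fderiv_fun_sum fun t _ => (hd t).const_mul (c t)]
  simp [fderiv_const_mul (hd _)]

lemma pd2_sum_sum (W : Matrix (Fin n) (Fin n) ℝ) (Ω : (Fin n → ℝ) → Fin n → Fin n → ℝ)
    (hΩ : ∀ i j, ContDiff ℝ (⊤ : ℕ∞) fun x => Ω x i j) (i j : Fin n) (x : Fin n → ℝ) :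
    pd2 i j (fun y => ∑ r, ∑ s, W r s * Ω y r s) x
      = ∑ r, ∑ s, W r s * pd2 i j (fun y => Ω y r s) x := by
  simp only [← Fintype.sum_prod_type']
  unfold pd2
  rw [pd_sum _ (fun t : Fin n × Fin n => W t.1 t.2) (fun t y => Ω y t.1 t.2) fun t => hΩ _ _,
    pd_sum _ (fun t : Fin n × Fin n => W t.1 t.2) (fun t => pd j fun y => Ω y t.1 t.2)
      fun t => pd_contDiff _ (hΩ _ _)]

lemma integral_mul_pd (i : Fin n) (hf : ContDiff ℝ (⊤ : ℕ∞) f) (hg : ContDiff ℝ (⊤ : ℕ∞) g)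
    (hfs : HasCompactSupport f) : ∫ x, f x * pd i g x = -∫ x, pd i f x * g x := by
  apply integral_mul_fderiv_eq_neg_fderiv_mul_of_integrable
  · exact ((pd_contDiff i hf).continuous.mul hg.continuous).integrable_of_hasCompactSupport
      (pd_hasCompactSupport i hfs).mul_right
  · exact (hf.continuous.mul (pd_contDiff i hg).continuous).integrable_of_hasCompactSupport
      hfs.mul_right
  · exact (hf.continuous.mul hg.continuous).integrable_of_hasCompactSupport hfs.mul_right
  · exact fun x _ => (hf.differentiable (by simp)).differentiableAt
  · exact fun x _ => (hg.differentiable (by simp)).differentiableAt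

lemma integral_mul_pd2 (i j : Fin n) (hf : ContDiff ℝ (⊤ : ℕ∞) f)
    (hg : ContDiff ℝ (⊤ : ℕ∞) g) (hfs : HasCompactSupport f) :
    ∫ x, f x * pd2 i j g x = ∫ x, g x * pd2 i j f x := by
  have hpd := integral_mul_pd j (pd_contDiff i hf) hg (pd_hasCompactSupport i hfs)
  unfold pd2
  rw [integral_mul_pd i hf (pd_contDiff j hg) hfs, hpd, neg_neg]
  refine integral_congr_ae (.of_forall fun x => ?_)
  change pd2 j i f x * g x = g x * pd2 i j f x
  rw [pd2_comm j i hf, mul_comm]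

end PartialDerivatives

/-- The scalar built from an array `J k l a b p q`, standing for `λ_{kl} ∂_a∂_b Ω_{pq}` or for its
integral, by the contractions that occur in `2⟨λ, E(Ω)⟩_ω`. -/
def einsteinContraction {n : ℕ} (W : Matrix (Fin n) (Fin n) ℝ)
    (J : Fin n → Fin n → Fin n → Fin n → Fin n → Fin n → ℝ) : ℝ :=
  ∑ t : Fin n × Fin n × Fin n × Fin n × Fin n × Fin n,
    match t with
    | (i, j, k, l, r, s) => W i k * W j l * W r s *
        (J k l r s i j + J k l i j r s + J r s i j k l
          - J k l r i s j - J k l r j s i - J i k j l r s)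

section Contraction

variable {n : ℕ} {W : Matrix (Fin n) (Fin n) ℝ}

lemma einsteinContraction_transpose (hW : W.IsSymm)
    {J J' : Fin n → Fin n → Fin n → Fin n → Fin n → Fin n → ℝ}
    (hJ : ∀ k l a b p q, J k l a b p q = J' p q a b k l)
    (hd : ∀ k l a b p q, J' k l a b p q = J' k l b a p q)
    (hl : ∀ k l a b p q, J' k l a b p q = J' l k a b p q)
    (hr : ∀ k l a b p q, J' k l a b p q = J' k l a b q p) :
    einsteinContraction W J = einsteinContraction W J' := by
  have hs (a b : Fin n) : W a b = W b a := hW.apply b a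
  let T := Fin n × Fin n × Fin n × Fin n × Fin n × Fin n
  have h₁ : ∑ t : T, (match t with
        | (i, j, k, l, r, s) => W i k * W j l * W r s * J k l r s i j)
      = ∑ t : T, (match t with
        | (i, j, k, l, r, s) => W i k * W j l * W r s * J' k l r s i j) :=
    Fintype.sum_equiv
      ⟨fun (i, j, k, l, r, s) => (k, l, i, j, r, s), fun (i, j, k, l, r, s) => (k, l, i, j, r, s),
        fun _ => rfl, fun _ => rfl⟩ _ _ fun (i, j, k, l, r, s) => by
      simp only [Equiv.coe_fn_mk]
      rw [hJ, hs i k, hs j l]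
  have h₂ : ∑ t : T, (match t with
        | (i, j, k, l, r, s) => W i k * W j l * W r s * J k l r i s j)
      = ∑ t : T, (match t with
        | (i, j, k, l, r, s) => W i k * W j l * W r s * J' k l r i s j) :=
    Fintype.sum_equiv
      ⟨fun (i, j, k, l, r, s) => (r, l, s, j, i, k), fun (i, j, k, l, r, s) => (r, l, s, j, i, k),
        fun _ => rfl, fun _ => rfl⟩ _ _ fun (i, j, k, l, r, s) => by
      simp only [Equiv.coe_fn_mk]
      rw [hJ, hd, hs j l]
      ring
  have h₃ : ∑ t : T, (match t with
        | (i, j, k, l, r, s) => W i k * W j l * W r s * J k l r j s i)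
      = ∑ t : T, (match t with
        | (i, j, k, l, r, s) => W i k * W j l * W r s * J' k l r j s i) :=
    Fintype.sum_equiv
      ⟨fun (i, j, k, l, r, s) => (k, r, i, s, j, l), fun (i, j, k, l, r, s) => (k, r, i, s, j, l),
        fun _ => rfl, fun _ => rfl⟩ _ _ fun (i, j, k, l, r, s) => by
      simp only [Equiv.coe_fn_mk]
      rw [hJ, hd, hl, hr, hs i k]
      ring
  have h₄ : ∑ t : T, (match t with
        | (i, j, k, l, r, s) => W i k * W j l * W r s * J i k j l r s)
      = ∑ t : T, (match t with
        | (i, j, k, l, r, s) => W i k * W j l * W r s * J' i k j l r s) :=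
    Fintype.sum_equiv
      ⟨fun (i, j, k, l, r, s) => (r, j, s, l, i, k), fun (i, j, k, l, r, s) => (r, j, s, l, i, k),
        fun _ => rfl, fun _ => rfl⟩ _ _ fun (i, j, k, l, r, s) => by
      simp only [Equiv.coe_fn_mk]
      rw [hJ]
      ring
  simp only [einsteinContraction, mul_add, mul_sub, Finset.sum_add_distrib,
    Finset.sum_sub_distrib]
  rw [h₁, h₂, h₃, h₄]
  simp only [hJ]
  ring

lemma sum_mul_mul_eq_of_mul_eq_one {ω : Matrix (Fin n) (Fin n) ℝ} (hW : W.IsSymm)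
    (hinv : ω * W = 1) (k l : Fin n) : ∑ i, ∑ j, W i k * W j l * ω i j = W k l := by
  have h (i : Fin n) : ∑ j, ω i j * W j l = (1 : Matrix (Fin n) (Fin n) ℝ) i l := by
    rw [← hinv, Matrix.mul_apply]
  calc ∑ i, ∑ j, W i k * W j l * ω i j = ∑ i, W i k * ∑ j, ω i j * W j l := by
        simp only [Finset.mul_sum]
        exact Finset.sum_congr rfl fun i _ => Finset.sum_congr rfl fun j _ => by ring
    _ = W k l := by simp [h, Matrix.one_apply, hW.apply k l]

/-- A quadruple sum weighted by `W i k * W j l * ω i j` collapses to a trace. -/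
lemma sum_mul_mul_mul_eq_of_mul_eq_one {ω : Matrix (Fin n) (Fin n) ℝ} (hW : W.IsSymm)
    (hinv : ω * W = 1) (L : Fin n → Fin n → ℝ) (C : ℝ) :
    ∑ i, ∑ j, ∑ k, ∑ l, W i k * W j l * L k l * (ω i j * C) = ∑ k, ∑ l, W k l * L k l * C := by
  calc _ = ∑ p : Fin n × Fin n, ∑ q : Fin n × Fin n,
        W p.1 q.1 * W p.2 q.2 * L q.1 q.2 * (ω p.1 p.2 * C) := by
        simp only [Fintype.sum_prod_type]
    _ = ∑ q : Fin n × Fin n, (∑ i, ∑ j, W i q.1 * W j q.2 * ω i j) * (L q.1 q.2 * C) := by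
        rw [Finset.sum_comm]
        refine Finset.sum_congr rfl fun q _ => ?_
        rw [← Fintype.sum_prod_type', Finset.sum_mul]
        exact Finset.sum_congr rfl fun p _ => by ring
    _ = _ := by
        simp only [sum_mul_mul_eq_of_mul_eq_one hW hinv]
        simp only [Fintype.sum_prod_type, mul_assoc]

lemma sum_einstein_eq_einsteinContraction {ω : Matrix (Fin n) (Fin n) ℝ} (hW : W.IsSymm)
    (hinv : ω * W = 1) (L : Fin n → Fin n → ℝ) (D : Fin n → Fin n → Fin n → Fin n → ℝ) :
    ∑ i, ∑ j, ∑ k, ∑ l, W i k * W j l * L k l *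
      ((1 / 2) * ((∑ r, ∑ s, W r s * D r s i j) + (∑ r, ∑ s, W r s * D i j r s)
        - (∑ r, ∑ s, W r s * (D r i s j + D r j s i))
        - ω i j * ((∑ r, ∑ s, W r s * ∑ u, ∑ v, W u v * D r s u v)
          - ∑ r, ∑ u, ∑ s, ∑ v, W r u * W s v * D r s u v)))
      = (1 / 2) * einsteinContraction W fun k l a b p q => L k l * D a b p q := by
  set C := (∑ r, ∑ s, W r s * ∑ u, ∑ v, W u v * D r s u v)
    - ∑ r, ∑ u, ∑ s, ∑ v, W r u * W s v * D r s u v with hC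
  let T := Fin n × Fin n × Fin n × Fin n × Fin n × Fin n
  have hmain : ∑ i, ∑ j, ∑ k, ∑ l, W i k * W j l * L k l *
        ((∑ r, ∑ s, W r s * D r s i j) + (∑ r, ∑ s, W r s * D i j r s)
          - (∑ r, ∑ s, W r s * (D r i s j + D r j s i)))
      = ∑ t : T, (match t with
        | (i, j, k, l, r, s) => W i k * W j l * W r s *
          (L k l * D r s i j + L k l * D i j r s - L k l * D r i s j - L k l * D r j s i)) := by
    simp only [T, Fintype.sum_prod_type, ← Finset.sum_add_distrib, ← Finset.sum_sub_distrib,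
      Finset.mul_sum]
    refine Finset.sum_congr rfl fun i _ => Finset.sum_congr rfl fun j _ =>
      Finset.sum_congr rfl fun k _ => Finset.sum_congr rfl fun l _ =>
      Finset.sum_congr rfl fun r _ => Finset.sum_congr rfl fun s _ => by ring
  have hbox : ∑ k, ∑ l, W k l * L k l * (∑ r, ∑ s, W r s * ∑ u, ∑ v, W u v * D r s u v)
      = ∑ t : T, (match t with
        | (i, j, k, l, r, s) => W i k * W j l * W r s * (L i k * D j l r s)) := by
    simp only [Finset.mul_sum]
    simp only [← Fintype.sum_prod_type']
    exact Fintype.sum_equiv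
      ⟨fun (k, l, r, s, u, v) => (k, r, l, s, u, v),
        fun (i, j, k, l, r, s) => (i, k, j, l, r, s), fun _ => rfl, fun _ => rfl⟩ _ _
      fun (k, l, r, s, u, v) => by simp only [Equiv.coe_fn_mk]; ring
  have hdiv : ∑ k, ∑ l, W k l * L k l * (∑ r, ∑ u, ∑ s, ∑ v, W r u * W s v * D r s u v)
      = ∑ t : T, (match t with
        | (i, j, k, l, r, s) => W i k * W j l * W r s * (L r s * D i j k l)) := by
    simp only [Finset.mul_sum]
    simp only [← Fintype.sum_prod_type']
    exact Fintype.sum_equiv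
      ⟨fun (k, l, r, u, s, v) => (r, s, u, v, k, l),
        fun (i, j, k, l, r, s) => (r, s, i, k, j, l), fun _ => rfl, fun _ => rfl⟩ _ _
      fun (k, l, r, u, s, v) => by simp only [Equiv.coe_fn_mk]; ring
  have hω := sum_mul_mul_mul_eq_of_mul_eq_one hW hinv L C
  simp only [mul_left_comm _ (1 / 2 : ℝ), ← Finset.mul_sum]
  congr 1
  simp only [mul_sub _ _ (ω _ _ * C), Finset.sum_sub_distrib]
  rw [hmain, hω, hC]
  simp only [mul_sub (W _ _ * L _ _), Finset.sum_sub_distrib]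
  rw [hbox, hdiv, einsteinContraction, ← Finset.sum_sub_distrib, ← Finset.sum_sub_distrib]
  exact Finset.sum_congr rfl fun (i, j, k, l, r, s) _ => by ring

lemma integral_einsteinContraction {X : Type*} [MeasurableSpace X] {μ : Measure X}
    {K : X → Fin n → Fin n → Fin n → Fin n → Fin n → Fin n → ℝ}
    (hK : ∀ k l a b p q, Integrable (fun x => K x k l a b p q) μ) :
    ∫ x, einsteinContraction W (K x) ∂μ
      = einsteinContraction W fun k l a b p q => ∫ x, K x k l a b p q ∂μ := by
  unfold einsteinContraction
  rw [integral_finsetSum]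
  · refine Finset.sum_congr rfl fun (i, j, k, l, r, s) _ => ?_
    simp only
    rw [integral_const_mul, integral_sub (by fun_prop) (by fun_prop),
      integral_sub (by fun_prop) (by fun_prop), integral_sub (by fun_prop) (by fun_prop),
      integral_add (by fun_prop) (by fun_prop), integral_add (by fun_prop) (by fun_prop)]
  · rintro ⟨i, j, k, l, r, s⟩ -
    fun_prop

end Contraction

lemma integral_pairing_einsteinOp {n : ℕ} {ω ωinv : Matrix (Fin n) (Fin n) ℝ}
    (hW : ωinv.IsSymm) (hinv : ω * ωinv = 1) {Ω lam : (Fin n → ℝ) → Fin n → Fin n → ℝ}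
    (hΩ : ∀ i j, ContDiff ℝ (⊤ : ℕ∞) fun x => Ω x i j)
    (hl : ∀ i j, ContDiff ℝ (⊤ : ℕ∞) fun x => lam x i j)
    (hls : ∀ i j, HasCompactSupport fun x => lam x i j) :
    ∫ x : Fin n → ℝ, ∑ i, ∑ j, ∑ k, ∑ l,
        ωinv i k * ωinv j l * lam x k l * einsteinOp ω ωinv Ω i j x
      = (1 / 2) * einsteinContraction ωinv fun k l a b p q =>
          ∫ x, lam x k l * pd2 a b (fun y => Ω y p q) x := by
  rw [← integral_einsteinContraction, ← integral_const_mul]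
  · refine integral_congr_ae (.of_forall fun x => ?_)
    simp only [einsteinOp, pd2_sum_sum ωinv Ω hΩ]
    exact sum_einstein_eq_einsteinContraction hW hinv (lam x)
      fun a b p q => pd2 a b (fun y => Ω y p q) x
  · intro k l a b p q
    exact ((hl k l).continuous.mul
      (pd2_contDiff a b (hΩ p q)).continuous).integrable_of_hasCompactSupport (hls k l).mul_right

/-- The linearized Einstein operator is formally self-adjoint with respect to the
pairing `⟨A,B⟩_ω = Σ ω^{ik} ω^{jl} A_{ij} B_{kl}`. -/
theorem einstein_formally_self_adjoint (n : ℕ) (hn : 2 ≤ n)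
    (ω ωinv : Matrix (Fin n) (Fin n) ℝ) (hωsym : ω.IsSymm)
    (hinv : ω * ωinv = 1) (hinv' : ωinv * ω = 1)
    (Ω lam : (Fin n → ℝ) → Fin n → Fin n → ℝ)
    (hΩsmooth : ∀ i j, ContDiff ℝ (⊤ : ℕ∞) fun x => Ω x i j)
    (hΩsupp : ∀ i j, HasCompactSupport fun x => Ω x i j)
    (hΩsym : ∀ x i j, Ω x i j = Ω x j i)
    (hlsmooth : ∀ i j, ContDiff ℝ (⊤ : ℕ∞) fun x => lam x i j)
    (hlsupp : ∀ i j, HasCompactSupport fun x => lam x i j)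
    (hlsym : ∀ x i j, lam x i j = lam x j i) :
    ∫ x : Fin n → ℝ, ∑ i, ∑ j, ∑ k, ∑ l,
        ωinv i k * ωinv j l * lam x k l * einsteinOp ω ωinv Ω i j x
      = ∫ x : Fin n → ℝ, ∑ i, ∑ j, ∑ k, ∑ l,
          ωinv i k * ωinv j l * Ω x k l * einsteinOp ω ωinv lam i j x := by
  have hW : ωinv.IsSymm := by
    rw [← Matrix.inv_eq_right_inv hinv]
    exact hωsym.inv
  rw [integral_pairing_einsteinOp hW hinv hΩsmooth hlsmooth hlsupp,
    integral_pairing_einsteinOp hW hinv hlsmooth hΩsmooth hΩsupp]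
  congr 1
  refine einsteinContraction_transpose hW ?_ ?_ ?_ ?_ <;> intro k l a b p q
  · exact integral_mul_pd2 a b (hlsmooth k l) (hΩsmooth p q) (hlsupp k l)
  · simp only [pd2_comm a b (hlsmooth p q)]
  · simp only [hΩsym _ k l]
  · simp only [hlsym _ p q]
end

section
/- (Beltrami parametrization of the Cauchy operator.) Let σ : ℝ³ → Sym(3,ℝ) be a smooth symmetric-matrix-valued map satisfying the Cauchy stress equations Σ_{j=1}^{3} ∂_j σ_{ij} = 0 on ℝ³ for each i. Then there exists a smooth symmetric-matrix-valued map φ : ℝ³ → Sym(3,ℝ) (six stress functions) such that σ_{ij} = Σ_{k,l,m,p} ε_{ikl} ε_{jmp} ∂_k∂_m φ_{lp} for all i,j. -/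
/-- The Levi-Civita symbol on three indices. -/
noncomputable def lc (i j k : Fin 3) : ℝ :=
  (((j : ℕ) : ℝ) - ((i : ℕ) : ℝ)) * (((k : ℕ) : ℝ) - ((i : ℕ) : ℝ))
    * (((k : ℕ) : ℝ) - ((j : ℕ) : ℝ)) / 2

open Set Filter Topology MeasureTheory intervalIntegral
open scoped ContDiff

section ParametricIntegral

variable {E G : Type*} [NormedAddCommGroup E] [NormedSpace ℝ E] [FiniteDimensional ℝ E]
  [NormedAddCommGroup G] [NormedSpace ℝ G]

/-- Differentiation under the integral sign for a `C¹` integrand over a compact interval. -/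
theorem hasFDerivAt_intervalIntegral_of_contDiff {F : E × ℝ → G} (hF : ContDiff ℝ 1 F)
    (a b : ℝ) (x₀ : E) :
    HasFDerivAt (fun x => ∫ t in a..b, F (x, t))
      (∫ t in a..b, (fderiv ℝ F (x₀, t)).comp (ContinuousLinearMap.inl ℝ E ℝ)) x₀ := by
  have hF' : Continuous fun p : E × ℝ =>
      (fderiv ℝ F p).comp (ContinuousLinearMap.inl ℝ E ℝ) :=
    (hF.continuous_fderiv one_ne_zero).clm_comp continuous_const
  have hFc := hF.continuous
  obtain ⟨C, hC⟩ := ((isCompact_closedBall x₀ (1 : ℝ)).prod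
    (isCompact_uIcc (a := a) (b := b))).exists_bound_of_continuousOn hF'.continuousOn
  refine hasFDerivAt_integral_of_dominated_of_fderiv_le'' (bound := fun _ => C)
    (F := fun x t => F (x, t))
    (F' := fun x t => (fderiv ℝ F (x, t)).comp (ContinuousLinearMap.inl ℝ E ℝ))
    (Metric.closedBall_mem_nhds x₀ one_pos) ?_ ?_ ?_ ?_ ?_ ?_
  · exact Eventually.of_forall fun x =>
      (by fun_prop : Continuous fun t => F (x, t)).aestronglyMeasurable
  · exact (by fun_prop : Continuous fun t => F (x₀, t)).intervalIntegrable _ _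
  · exact (hF'.comp (by fun_prop : Continuous fun t : ℝ => (x₀, t))).aestronglyMeasurable
  · refine (ae_restrict_mem measurableSet_uIoc).mono fun t ht x hx => ?_
    exact hC (x, t) ⟨hx, uIoc_subset_uIcc ht⟩
  · exact intervalIntegrable_const
  · refine Eventually.of_forall fun t x _ => ?_
    exact ((hF.differentiable one_ne_zero) (x, t)).hasFDerivAt.comp x (hasFDerivAt_prodMk_left x t)

/-- A parametric integral over a compact interval of a smooth integrand is smooth. -/
theorem contDiff_intervalIntegral {F : E × ℝ → ℝ} (hF : ContDiff ℝ ∞ F) (a b : ℝ) :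
    ContDiff ℝ ∞ fun x => ∫ t in a..b, F (x, t) := by
  rw [contDiff_infty]
  intro n
  induction n generalizing F with
  | zero =>
    have hFc := hF.continuous
    exact contDiff_zero.2 (continuous_parametric_intervalIntegral_of_continuous'
      (f := fun x t => F (x, t)) (by fun_prop) a b)
  | succ n ih =>
    have h1 : ContDiff ℝ 1 F := hF.of_le (by exact_mod_cast le_top)
    have hd := hasFDerivAt_intervalIntegral_of_contDiff h1 a b
    have hF' : ContDiff ℝ ∞ (fderiv ℝ F) := hF.fderiv_right (by simp)
    push_cast
    rw [contDiff_succ_iff_fderiv_apply]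
    refine ⟨fun x => (hd x).differentiableAt, by simp, fun y => ?_⟩
    convert ih (F := fun p => fderiv ℝ F p (y, 0)) (by fun_prop) using 2 with x
    rw [(hd x).fderiv, ContinuousLinearMap.intervalIntegral_apply]
    · simp
    · have := hF'.continuous
      exact (by fun_prop : Continuous fun t : ℝ =>
        (fderiv ℝ F (x, t)).comp (ContinuousLinearMap.inl ℝ E ℝ)).intervalIntegrable _ _

end ParametricIntegral

section PartialDerivatives

variable {n : ℕ} {u v : (Fin n → ℝ) → ℝ}

theorem ContDiff.partialDeriv (hu : ContDiff ℝ ∞ u) (i : Fin n) : ContDiff ℝ ∞ (pd i u) :=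
  (hu.fderiv_right (m := ∞) (by simp)).clm_apply contDiff_const

theorem ContDiff.differentiable_infty (hu : ContDiff ℝ ∞ u) : Differentiable ℝ u :=
  hu.differentiable (by simp)

theorem pd_comm (hu : ContDiff ℝ ∞ u) (i j : Fin n) : pd i (pd j u) = pd j (pd i u) := by
  have hd : Differentiable ℝ (fderiv ℝ u) :=
    (hu.fderiv_right (m := ∞) (by simp)).differentiable (by simp)
  have key : ∀ (k l : Fin n) x, pd k (pd l u) x
      = fderiv ℝ (fderiv ℝ u) x (Pi.single k 1) (Pi.single l 1) := by
    intro k l x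
    have := (hd x).hasFDerivAt.clm_apply (hasFDerivAt_const (Pi.single l (1 : ℝ)) x)
    unfold pd
    rw [this.fderiv]
    simp
  funext x
  rw [key, key]
  exact (hu.contDiffAt.isSymmSndFDerivAt (by
    rw [minSmoothness_of_isRCLikeNormedField]
    exact WithTop.coe_le_coe.2 le_top)) _ _

@[simp] theorem pd_zero (i : Fin n) : pd i (fun _ => (0 : ℝ)) = fun _ => 0 := by
  funext x; simp [pd]

theorem pd_add (hu : ContDiff ℝ ∞ u) (hv : ContDiff ℝ ∞ v) (i : Fin n) (x : Fin n → ℝ) :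
    pd i (fun y => u y + v y) x = pd i u x + pd i v x := by
  simp [pd, fderiv_fun_add (hu.differentiable_infty x) (hv.differentiable_infty x)]

theorem pd_sub (hu : ContDiff ℝ ∞ u) (hv : ContDiff ℝ ∞ v) (i : Fin n) (x : Fin n → ℝ) :
    pd i (fun y => u y - v y) x = pd i u x - pd i v x := by
  simp [pd, fderiv_fun_sub (hu.differentiable_infty x) (hv.differentiable_infty x)]

theorem pd_neg (i : Fin n) (x : Fin n → ℝ) : pd i (fun y => -u y) x = -pd i u x := by
  simp [pd, fderiv_fun_neg]

theorem hasDerivAt_comp_update (hu : Differentiable ℝ u) (i : Fin n) (x : Fin n → ℝ) (s : ℝ) :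
    HasDerivAt (fun r => u (Function.update x i r)) (pd i u (Function.update x i s)) s :=
  (hu _).hasFDerivAt.comp_hasDerivAt s (hasDerivAt_update x i s)

theorem pd_eq_deriv_update (hu : Differentiable ℝ u) (i : Fin n) (x : Fin n → ℝ) :
    pd i u x = deriv (fun r => u (Function.update x i r)) (x i) := by
  rw [(hasDerivAt_comp_update hu i x (x i)).deriv, Function.update_eq_self]

/-- A smooth function is determined by its `i`-th partial derivative and its values on the
hyperplane `x i = 0`. -/
theorem eq_of_pd_eq (hu : ContDiff ℝ ∞ u) (hv : ContDiff ℝ ∞ v) (i : Fin n)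
    (h : ∀ x, pd i u x = pd i v x) (h0 : ∀ x, x i = 0 → u x = v x) (x : Fin n → ℝ) :
    u x = v x := by
  have hw : ∀ s, HasDerivAt
      (fun r => u (Function.update x i r) - v (Function.update x i r)) 0 s := fun s => by
    have := (hasDerivAt_comp_update hu.differentiable_infty i x s).sub
      (hasDerivAt_comp_update hv.differentiable_infty i x s)
    rwa [h, sub_self] at this
  have := is_const_of_deriv_eq_zero (fun s => (hw s).differentiableAt) (fun s => (hw s).deriv)
    (x i) 0
  simp only [Function.update_eq_self] at this
  rw [h0 (Function.update x i 0) (by simp), sub_self] at this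
  exact sub_eq_zero.1 this

/-- Functions agreeing on the hyperplane `x i = 0` have the same tangential derivatives there. -/
theorem pd_eq_of_eq_on_hyperplane (hu : ContDiff ℝ ∞ u) (hv : ContDiff ℝ ∞ v) {i j : Fin n}
    (hij : i ≠ j) (h0 : ∀ x, x i = 0 → u x = v x) (x : Fin n → ℝ) (hx : x i = 0) :
    pd j u x = pd j v x := by
  rw [pd_eq_deriv_update hu.differentiable_infty, pd_eq_deriv_update hv.differentiable_infty]
  congr 1
  funext r
  exact h0 _ (by simp [Function.update_of_ne hij, hx])

/-- Every smooth `f` is the `i`-th partial derivative of a smooth function with prescribed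
(smooth) values on the hyperplane `x i = 0`. -/
theorem exists_pd_eq {f g : (Fin n → ℝ) → ℝ} (hf : ContDiff ℝ ∞ f) (hg : ContDiff ℝ ∞ g)
    (i : Fin n) : ∃ u, ContDiff ℝ ∞ u ∧ (∀ x, pd i u x = f x) ∧ ∀ x, x i = 0 → u x = g x := by
  have hupd : ContDiff ℝ ∞ fun p : (Fin n → ℝ) × ℝ => Function.update p.1 i p.2 := by
    rw [contDiff_pi]
    intro j
    by_cases hj : j = i
    · subst hj; simpa using contDiff_snd
    · simp only [Function.update_of_ne hj]; fun_prop
  have hI : ∀ (x : Fin n → ℝ) (c : ℝ), c * ∫ t in (0 : ℝ)..1, f (Function.update x i (t * c))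
      = ∫ s in (0 : ℝ)..c, f (Function.update x i s) := fun x c => by
    simpa using mul_integral_comp_mul_right (a := 0) (b := 1)
      (f := fun s => f (Function.update x i s)) c
  have hus : ContDiff ℝ ∞ fun x : Fin n → ℝ => g (Function.update x i 0)
      + x i * ∫ t in (0 : ℝ)..1, f (Function.update x i (t * x i)) := by
    refine (hg.comp (hupd.comp (contDiff_id.prodMk contDiff_const))).add
      (.mul (contDiff_apply ℝ ℝ i) ?_)
    refine contDiff_intervalIntegral
      (F := fun p : (Fin n → ℝ) × ℝ => f (Function.update p.1 i (p.2 * p.1 i))) ?_ 0 1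
    exact hf.comp (hupd.comp (contDiff_fst.prodMk (by fun_prop)))
  refine ⟨_, hus, fun x => ?_, fun x hx => ?_⟩
  · rw [pd_eq_deriv_update hus.differentiable_infty]
    simp only [Function.update_idem, Function.update_self, hI]
    rw [deriv_const_add]
    have hc : Continuous fun s => f (Function.update x i s) := by
      have := hf.continuous
      fun_prop
    rw [hc.deriv_integral, Function.update_eq_self]
  · simp only [hx, zero_mul, add_zero]
    rw [← hx, Function.update_eq_self]

end PartialDerivatives

/-- Beltrami parametrization of the Cauchy operator: every smooth symmetric stress tensor
`σ` on `ℝ³` satisfying the Cauchy stress equations `Σ_j ∂_j σ_{ij} = 0` is of the form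
`σ_{ij} = Σ ε_{ikl} ε_{jmp} ∂_k∂_m φ_{lp}` for six smooth stress functions `φ_{lp} = φ_{pl}`. -/
theorem beltrami_parametrization
    (σ : (Fin 3 → ℝ) → Fin 3 → Fin 3 → ℝ)
    (hsmooth : ∀ i j, ContDiff ℝ (⊤ : ℕ∞) fun x => σ x i j)
    (hsym : ∀ x i j, σ x i j = σ x j i)
    (hdiv : ∀ x i, (∑ j, pd j (fun y => σ y i j) x) = 0) :
    ∃ φ : (Fin 3 → ℝ) → Fin 3 → Fin 3 → ℝ,
      (∀ i j, ContDiff ℝ (⊤ : ℕ∞) fun x => φ x i j) ∧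
      (∀ x i j, φ x i j = φ x j i) ∧
      (∀ x i j, σ x i j
        = ∑ k, ∑ l, ∑ m, ∑ p, lc i k l * lc j m p * pd2 k m (fun y => φ y l p) x) := by
  have h0 : ContDiff ℝ ∞ fun _ : Fin 3 → ℝ => (0 : ℝ) := contDiff_const
  have hsymf : ∀ i j, (fun x => σ x i j) = fun x => σ x j i := fun i j => funext fun x => hsym x i j
  have hd : ∀ i x, pd 0 (fun y => σ y i 0) x + pd 1 (fun y => σ y i 1) x
      + pd 2 (fun y => σ y i 2) x = 0 := fun i x => by
    simpa [Fin.sum_univ_three] using hdiv x i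
  obtain ⟨b₁, hb₁, db₁, -⟩ := exists_pd_eq (hsmooth 0 2).neg h0 0
  obtain ⟨a₁, ha₁, da₁, -⟩ := exists_pd_eq (hsmooth 1 2).neg h0 1
  obtain ⟨e₁, he₁, de₁, -⟩ := exists_pd_eq (hsmooth 2 2) h0 0
  obtain ⟨e, he, de, -⟩ := exists_pd_eq he₁ h0 0
  obtain ⟨b', hb', db', rb'⟩ := exists_pd_eq (hsmooth 0 0) hb₁ 2
  obtain ⟨a', ha', da', ra'⟩ := exists_pd_eq (hsmooth 1 1) ha₁ 2
  obtain ⟨c', hc', dc', rc'⟩ := exists_pd_eq (hsmooth 0 1).neg h0 2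
  obtain ⟨b, hb, db, rb⟩ := exists_pd_eq hb' he 2
  obtain ⟨a, ha, da, ra⟩ := exists_pd_eq ha' h0 2
  obtain ⟨c, hc, dc, rc⟩ := exists_pd_eq hc' h0 2
  replace db₁ := funext db₁
  replace da₁ := funext da₁
  replace de₁ := funext de₁
  replace de := funext de
  replace db' := funext db'
  replace da' := funext da'
  replace dc' := funext dc'
  replace db := funext db
  replace da := funext da
  replace dc := funext dc
  have E02 : ∀ x, σ x 0 2 = pd 1 c' x - pd 0 b' x := by
    refine eq_of_pd_eq (hsmooth 0 2) ((hc'.partialDeriv 1).sub (hb'.partialDeriv 0)) 2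
      (fun x => ?_) fun x hx => ?_
    · rw [pd_sub (hc'.partialDeriv 1) (hb'.partialDeriv 0), pd_comm hc', pd_comm hb', dc', db', pd_neg]
      linarith [hd 0 x]
    · rw [pd_eq_of_eq_on_hyperplane hc' h0 (by decide) rc' x hx,
        pd_eq_of_eq_on_hyperplane hb' hb₁ (by decide) rb' x hx, db₁]
      simp
  have E12 : ∀ x, σ x 1 2 = pd 0 c' x - pd 1 a' x := by
    refine eq_of_pd_eq (hsmooth 1 2) ((hc'.partialDeriv 0).sub (ha'.partialDeriv 1)) 2
      (fun x => ?_) fun x hx => ?_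
    · rw [pd_sub (hc'.partialDeriv 0) (ha'.partialDeriv 1), pd_comm hc', pd_comm ha', dc', da', pd_neg, hsymf 0 1]
      linarith [hd 1 x]
    · rw [pd_eq_of_eq_on_hyperplane hc' h0 (by decide) rc' x hx,
        pd_eq_of_eq_on_hyperplane ha' ha₁ (by decide) ra' x hx, da₁]
      simp
  have E22 : ∀ x, σ x 2 2 = pd 0 (pd 0 b) x + pd 1 (pd 1 a) x
      - (pd 0 (pd 1 c) x + pd 0 (pd 1 c) x) := by
    have hb2 := (hb.partialDeriv 0).partialDeriv 0
    have ha2 := (ha.partialDeriv 1).partialDeriv 1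
    have hc2 := (hc.partialDeriv 1).partialDeriv 0
    refine eq_of_pd_eq (hsmooth 2 2) ((hb2.add ha2).sub (hc2.add hc2)) 2
      (fun x => ?_) fun x hx => ?_
    · rw [pd_sub (hb2.add ha2) (hc2.add hc2), pd_add hb2 ha2, pd_add hc2 hc2,
        pd_comm (hb.partialDeriv 0) 2 0, pd_comm hb 2 0, db, pd_comm (ha.partialDeriv 1) 2 1, pd_comm ha 2 1, da,
        pd_comm (hc.partialDeriv 1) 2 0, pd_comm hc 2 1, dc]
      have h2 := hd 2 x
      rw [hsymf 2 0, hsymf 2 1, funext E02, funext E12, pd_sub (hc'.partialDeriv 1) (hb'.partialDeriv 0),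
        pd_sub (hc'.partialDeriv 0) (ha'.partialDeriv 1), pd_comm hc' 1 0] at h2
      linarith
    · rw [pd_eq_of_eq_on_hyperplane (hb.partialDeriv 0) (he.partialDeriv 0) (by decide)
          (pd_eq_of_eq_on_hyperplane hb he (by decide) rb) x hx,
        pd_eq_of_eq_on_hyperplane (ha.partialDeriv 1) (h0.partialDeriv 1) (by decide)
          (pd_eq_of_eq_on_hyperplane ha h0 (by decide) ra) x hx,
        pd_eq_of_eq_on_hyperplane (hc.partialDeriv 1) (h0.partialDeriv 1) (by decide)
          (pd_eq_of_eq_on_hyperplane hc h0 (by decide) rc) x hx, de, de₁]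
      simp
  refine ⟨fun x => ![![a x, c x, 0], ![c x, b x, 0], ![0, 0, 0]], fun i j => ?_,
    fun x i j => ?_, fun x i j => ?_⟩
  · fin_cases i <;> fin_cases j <;> simp <;> assumption
  · fin_cases i <;> fin_cases j <;> simp
  · have c1 := congrFun (pd_comm hc 1 0) x
    have F00 := congrFun db' x
    have F11 := congrFun da' x
    have F01 := congrFun dc' x
    have F02 := E02 x
    have F12 := E12 x
    have F22 := E22 x
    have S1 := hsym x 1 0
    have S2 := hsym x 2 0
    have S3 := hsym x 2 1
    have q1 := congrFun (pd_comm ha 1 2) x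
    have q2 := congrFun (pd_comm hb 0 2) x
    have q3 := congrFun (pd_comm hc 0 2) x
    have q4 := congrFun (pd_comm hc 1 2) x
    rw [da] at q1
    rw [db] at q2
    rw [dc] at q3 q4
    fin_cases i <;> fin_cases j <;>
      simp [Fin.sum_univ_three, lc, pd2, da, db, dc] <;> norm_num <;> linarith
end

section
/- Let A be a commutative integral domain and M a finitely generated A-module. Let ε : M → M** = Hom_A(Hom_A(M,A),A) be the canonical evaluation morphism defined by ε(m)(f) = f(m) for all m ∈ M and f ∈ Hom_A(M,A). Then the kernel of ε equals the torsion submodule of M: ker(ε) = t(M) = {m ∈ M : ∃ a ∈ A, a ≠ 0, a·m = 0}. In particular, ε is injective if and only if M is torsion-free. -/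
open scoped nonZeroDivisors in
/-- A linear map from a finitely generated module to the field of fractions takes values in `A`
after multiplication by a common denominator. -/
theorem exists_dual_algebraMap_eq_smul {A K M : Type*} [CommRing A] [IsDomain A]
    [Field K] [Algebra A K] [IsFractionRing A K] [AddCommGroup M] [Module A M]
    [Module.Finite A M] (g : M →ₗ[A] K) :
    ∃ (b : A⁰) (h : Module.Dual A M), ∀ m, algebraMap A K (h m) = (b : A) • g m := by
  classical
  obtain ⟨s, hs⟩ := Module.Finite.fg_top (R := A) (M := M)
  obtain ⟨b, hb⟩ := IsLocalization.exist_integer_multiples_of_finset A⁰ (s.image g)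
  have hrange (m : M) : ((b : A) • g) m ∈ LinearMap.range (Algebra.linearMap A K) := by
    have hspan : Submodule.span A (s : Set M) ≤
        (LinearMap.range (Algebra.linearMap A K)).comap ((b : A) • g) :=
      Submodule.span_le.mpr fun x hx ↦ hb (g x) (Finset.mem_image_of_mem g hx)
    exact hspan (hs ▸ Submodule.mem_top)
  let e := LinearEquiv.ofInjective (Algebra.linearMap A K) (IsFractionRing.injective A K)
  refine ⟨b, e.symm.toLinearMap ∘ₗ ((b : A) • g).codRestrict _ hrange, fun m ↦ ?_⟩
  exact congrArg Subtype.val (e.apply_symm_apply (((b : A) • g).codRestrict _ hrange m))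

open scoped nonZeroDivisors in
/-- Over a domain, every non-torsion element of a finitely generated module is detected by a
linear form. -/
theorem exists_dual_apply_ne_zero_of_notMem_torsion {A M : Type*} [CommRing A] [IsDomain A]
    [AddCommGroup M] [Module A M] [Module.Finite A M] {m : M}
    (hm : m ∉ Submodule.torsion A M) : ∃ f : Module.Dual A M, f m ≠ 0 := by
  let ι := LocalizedModule.mkLinearMap A⁰ M
  have hιm : ι m ≠ 0 := fun h ↦
    hm ((Submodule.mem_torsion_iff m).mpr ((IsLocalizedModule.eq_zero_iff A⁰ ι).mp h))
  obtain ⟨φ, hφ⟩ : ∃ φ : Module.Dual (FractionRing A) (LocalizedModule A⁰ M), φ (ι m) ≠ 0 := by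
    simpa using (Module.forall_dual_apply_eq_zero_iff (FractionRing A) (ι m)).not.mpr hιm
  obtain ⟨b, f, hf⟩ := exists_dual_algebraMap_eq_smul (φ.restrictScalars A ∘ₗ ι)
  refine ⟨f, fun h ↦ ?_⟩
  have hzero : (b : A) • φ (ι m) = 0 := by simpa [h] using (hf m).symm
  exact (smul_ne_zero (nonZeroDivisors.ne_zero b.2) hφ) hzero

/-- For a finitely generated module `M` over a commutative integral domain `A`, the kernel
of the canonical evaluation map `ε : M → M** = Hom_A(Hom_A(M,A),A)`, `ε(m)(f) = f(m)`,
is exactly the torsion submodule `t(M)`; in particular `ε` is injective if and only if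
`M` is torsion-free. -/
theorem ker_eval_eq_torsion
    (A : Type*) [CommRing A] [IsDomain A]
    (M : Type*) [AddCommGroup M] [Module A M] [Module.Finite A M] :
    LinearMap.ker (Module.Dual.eval A M) = Submodule.torsion A M ∧
      (Function.Injective (Module.Dual.eval A M) ↔ Submodule.torsion A M = ⊥) := by
  have hker : LinearMap.ker (Module.Dual.eval A M) = Submodule.torsion A M := by
    ext m
    rw [LinearMap.mem_ker]
    constructor
    · intro h
      by_contra hm
      obtain ⟨f, hf⟩ := exists_dual_apply_ne_zero_of_notMem_torsion hm
      exact hf (LinearMap.congr_fun h f)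
    · intro h
      obtain ⟨a, ha⟩ := (Submodule.mem_torsion_iff m).mp h
      ext f
      have hzero : (a : A) * f m = 0 := by
        rw [← smul_eq_mul, ← map_smul]
        exact (congrArg f ha).trans (map_zero f)
      exact (mul_eq_zero.mp hzero).resolve_left (nonZeroDivisors.ne_zero a.2)
  exact ⟨hker, by rw [← LinearMap.ker_eq_bot, hker]⟩
end

section
/- For every natural number n, the real vector space V_n of all maps R : (Fin n)⁴ → ℝ, written R_{ijkl}, satisfying for all indices the algebraic Riemann tensor symmetries R_{ijkl} = −R_{jikl}, R_{ijkl} = −R_{ijlk}, and the first Bianchi identity R_{ijkl} + R_{iklj} + R_{iljk} = 0, has finite dimension dim_ℝ V_n = n²(n²−1)/12. -/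
/-- The space of algebraic Riemann tensors on `ℝⁿ`: maps `R : (Fin n)⁴ → ℝ` with
`R_{ijkl} = −R_{jikl}`, `R_{ijkl} = −R_{ijlk}` and the first Bianchi identity
`R_{ijkl} + R_{iklj} + R_{iljk} = 0`. -/
def riemannSym (n : ℕ) : Submodule ℝ (Fin n → Fin n → Fin n → Fin n → ℝ) where
  carrier := {R | (∀ i j k l, R i j k l = - R j i k l) ∧
    (∀ i j k l, R i j k l = - R i j l k) ∧
    (∀ i j k l, R i j k l + R i k l j + R i l j k = 0)}
  zero_mem' := by
    refine ⟨?_, ?_, ?_⟩ <;> intro i j k l <;> simp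
  add_mem' := by
    rintro a b ⟨ha1, ha2, ha3⟩ ⟨hb1, hb2, hb3⟩
    refine ⟨?_, ?_, ?_⟩ <;> intro i j k l <;> simp only [Pi.add_apply]
    · linear_combination ha1 i j k l + hb1 i j k l
    · linear_combination ha2 i j k l + hb2 i j k l
    · linear_combination ha3 i j k l + hb3 i j k l
  smul_mem' := by
    rintro c a ⟨ha1, ha2, ha3⟩
    refine ⟨?_, ?_, ?_⟩ <;> intro i j k l <;>
      simp only [Pi.smul_apply, smul_eq_mul]
    · linear_combination c * ha1 i j k l
    · linear_combination c * ha2 i j k l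
    · linear_combination c * ha3 i j k l

/-- Average of a 4-tensor, with signs, over the group of order 8 generated by the antisymmetries
in the first and in the last pair of indices and the exchange of the two pairs. -/
noncomputable def pairSymmetrize {n : ℕ} (R : Fin n → Fin n → Fin n → Fin n → ℝ)
    (i j k l : Fin n) : ℝ :=
  (R i j k l - R j i k l - R i j l k + R j i l k
    + R k l i j - R l k i j - R k l j i + R l k j i) / 8

/-- The Young-type projection of 4-tensors onto algebraic Riemann tensors. -/
noncomputable def riemannProj (n : ℕ) :
    (Fin n → Fin n → Fin n → Fin n → ℝ) →ₗ[ℝ] (Fin n → Fin n → Fin n → Fin n → ℝ) where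
  toFun R i j k l :=
    (2 * pairSymmetrize R i j k l - pairSymmetrize R i k l j - pairSymmetrize R i l j k) / 3
  map_add' R S := by
    ext i j k l
    simp only [pairSymmetrize, Pi.add_apply]
    ring
  map_smul' c R := by
    ext i j k l
    simp only [pairSymmetrize, Pi.smul_apply, smul_eq_mul, RingHom.id_apply]
    ring

theorem riemannProj_apply {n : ℕ} (R : Fin n → Fin n → Fin n → Fin n → ℝ) (i j k l : Fin n) :
    riemannProj n R i j k l =
      (2 * pairSymmetrize R i j k l - pairSymmetrize R i k l j - pairSymmetrize R i l j k) / 3 :=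
  rfl

theorem riemannSym_pair_symm {n : ℕ} {R : Fin n → Fin n → Fin n → Fin n → ℝ}
    (hR : R ∈ riemannSym n) (i j k l : Fin n) : R i j k l = R k l i j := by
  obtain ⟨h1, h2, h3⟩ := hR
  linarith [h3 i j k l, h3 j k l i, h3 k l i j, h3 l i j k,
    h1 i j k l, h1 i k l j, h1 i l j k, h1 j k l i, h1 j l i k, h1 k l i j,
    h2 i j k l, h2 i k l j, h2 i l j k, h2 j k l i, h2 j l i k, h2 k l i j,
    h2 j i k l, h2 k i l j, h2 l i j k, h2 k j l i, h2 l j i k, h2 l k i j]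

theorem isProj_riemannProj (n : ℕ) : LinearMap.IsProj (riemannSym n) (riemannProj n) where
  map_mem R := by
    refine ⟨?_, ?_, ?_⟩ <;> intro i j k l <;> simp only [riemannProj_apply, pairSymmetrize] <;> ring
  map_id R hR := by
    have hS : ∀ i j k l, pairSymmetrize R i j k l = R i j k l := fun i j k l ↦ by
      have hp := riemannSym_pair_symm hR
      obtain ⟨h1, h2, -⟩ := hR
      rw [pairSymmetrize]
      linarith [h1 i j k l, h2 i j k l, h2 j i k l, hp i j k l, hp j i k l, hp i j l k,
        hp j i l k]
    ext i j k l
    rw [riemannProj_apply, hS, hS, hS]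
    linarith [hR.2.2 i j k l]

/-- Four-fold currying of functions as a linear equivalence. -/
def curryFour (ι : Type*) : (ι × ι × ι × ι → ℝ) ≃ₗ[ℝ] (ι → ι → ι → ι → ℝ) where
  toFun f i j k l := f (i, j, k, l)
  invFun R x := R x.1 x.2.1 x.2.2.1 x.2.2.2
  map_add' _ _ := rfl
  map_smul' _ _ := rfl
  left_inv _ := rfl
  right_inv _ := rfl

theorem trace_eq_sum_curryFour {ι : Type*} [Fintype ι] [DecidableEq ι]
    (f : (ι → ι → ι → ι → ℝ) →ₗ[ℝ] (ι → ι → ι → ι → ℝ)) :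
    LinearMap.trace ℝ _ f =
      ∑ i, ∑ j, ∑ k, ∑ l, f (curryFour ι (Pi.single (i, j, k, l) 1)) i j k l := by
  rw [← LinearMap.trace_conj' f (curryFour ι).symm,
    LinearMap.trace_eq_matrix_trace ℝ (Pi.basisFun ℝ _), Matrix.trace, Fintype.sum_prod_type]
  simp only [Fintype.sum_prod_type]
  refine Finset.sum_congr rfl fun i _ ↦ Finset.sum_congr rfl fun j _ ↦
    Finset.sum_congr rfl fun k _ ↦ Finset.sum_congr rfl fun l _ ↦ ?_
  simp [LinearEquiv.conj_apply]
  rfl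

theorem trace_riemannProj (n : ℕ) :
    LinearMap.trace ℝ _ (riemannProj n) = (n : ℝ) ^ 2 * ((n : ℝ) ^ 2 - 1) / 12 := by
  rw [trace_eq_sum_curryFour]
  simp only [riemannProj_apply, pairSymmetrize, curryFour, LinearEquiv.coe_mk, LinearMap.coe_mk,
    AddHom.coe_mk, Pi.single_apply, Prod.mk.injEq, ite_and, ← Finset.sum_div,
    Finset.sum_sub_distrib, Finset.sum_add_distrib, ← Finset.mul_sum]
  simp [Finset.sum_ite_eq, Finset.sum_ite_eq']
  ring

/-- The space of algebraic Riemann tensors in dimension `n` has dimension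
`n²(n²−1)/12`. -/
theorem riemannSym_finrank (n : ℕ) :
    Module.finrank ℝ (riemannSym n) = n ^ 2 * (n ^ 2 - 1) / 12 := by
  have h := (isProj_riemannProj n).trace
  rw [trace_riemannProj] at h
  refine (Nat.div_eq_of_eq_mul_right (by norm_num) ?_).symm
  rcases Nat.eq_zero_or_pos n with rfl | hn
  · have : (Module.finrank ℝ (riemannSym 0) : ℝ) = 0 := by rw [← h]; simp
    rw [Nat.cast_eq_zero.mp this]
    simp
  · have h1 : 1 ≤ n ^ 2 := Nat.one_le_pow _ _ hn
    rw [← Nat.cast_inj (R := ℝ)]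
    push_cast [Nat.cast_sub h1]
    rw [← h]
    ring
end

section
/- (The third symbol of the conformal Killing system vanishes: ĝ₃ = 0.) Let n ≥ 3. If ξ : (Fin n)⁴ → ℝ, written ξ^k_{ijl}, is totally symmetric in the three lower indices i,j,l and satisfies ξ^k_{ijl} + ξ^i_{kjl} = (2/n)·δ_{ik}·Σ_{r=1}^{n} ξ^r_{rjl} for all i,j,k,l, then ξ = 0. Hence the conformal Killing system is of finite type in dimension n ≥ 3. -/
/-- If `T` solves `T^k_{ij} + T^i_{kj} = 2 δ_{ik} a_j` and is symmetric in its lower indices, then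
it is given by the Koszul-type formula `T^k_{ij} = δ_{ik} a_j + δ_{jk} a_i - δ_{ij} a_k`. -/
lemma eq_of_symm_of_add_swap {ι : Type*} [DecidableEq ι] (T : ι → ι → ι → ℝ) (a : ι → ℝ)
    (hsymm : ∀ k i j, T k i j = T k j i)
    (hadd : ∀ k i j, T k i j + T i k j = 2 * (if i = k then 1 else 0) * a j) (k i j : ι) :
    T k i j = (if i = k then 1 else 0) * a j + (if j = k then 1 else 0) * a i
      - (if j = i then 1 else 0) * a k := by
  linarith [hadd k i j, hadd k j i, hadd i j k, hsymm k i j, hsymm i j k, hsymm j i k]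

/-- For three or more indices, only `A = 0` makes `δ_{ik} A_{jl} + δ_{jk} A_{il} - δ_{ij} A_{kl}`
totally symmetric in `i, j, l`. -/
lemma eq_zero_of_koszul_symm {ι : Type*} [DecidableEq ι] (A : ι → ι → ℝ)
    (hι : ∀ a b : ι, ∃ c, c ≠ a ∧ c ≠ b)
    (hA : ∀ i j, A i j = A j i)
    (h : ∀ k i j l, (if i = k then 1 else 0) * A j l + (if j = k then 1 else 0) * A i l
        - (if j = i then 1 else 0) * A k l
      = (if i = k then 1 else 0) * A l j + (if l = k then 1 else 0) * A i j
        - (if l = i then 1 else 0) * A k j) (i l : ι) :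
    A i l = 0 := by
  have hneg : ∀ a b, a ≠ b → A a a = -A b b := fun a b hab ↦ by
    simpa [hab, hab.symm] using h b a b a
  obtain ⟨k, hki, hkl⟩ := hι i l
  by_cases hil : i = l
  · subst hil
    obtain ⟨m, hmi, hmk⟩ := hι i k
    linarith [hneg i k hki.symm, hneg i m hmi.symm, hneg k m hmk.symm]
  · simpa [hki, hki.symm, hkl.symm, hA l k, Ne.symm hil] using h k i k l

/-- The third symbol of the conformal Killing system vanishes in dimension `n ≥ 3`:
if `ξ = (ξ^k_{ijl})` (written `ξ k i j l`) is totally symmetric in the lower indices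
`i, j, l` and satisfies `ξ^k_{ijl} + ξ^i_{kjl} = (2/n)·δ_{ik}·Σ_r ξ^r_{rjl}`, then
`ξ = 0`. Hence the conformal Killing system is of finite type in dimension `n ≥ 3`. -/
theorem conformal_g3_eq_zero (n : ℕ) (hn : 3 ≤ n)
    (ξ : Fin n → Fin n → Fin n → Fin n → ℝ)
    (hsym1 : ∀ k i j l, ξ k i j l = ξ k j i l)
    (hsym2 : ∀ k i j l, ξ k i j l = ξ k i l j)
    (heq : ∀ k i j l, ξ k i j l + ξ i k j l
      = 2 / (n : ℝ) * (if i = k then 1 else 0) * ∑ r, ξ r r j l) :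
    ξ = 0 := by
  let A : Fin n → Fin n → ℝ := fun j l ↦ (∑ r, ξ r r j l) / n
  have hkoszul (k i j l) := eq_of_symm_of_add_swap (fun k i j ↦ ξ k i j l) (fun j ↦ A j l)
    (fun k i j ↦ hsym1 k i j l) (fun k i j ↦ by rw [heq]; simp only [A]; ring) k i j
  have hthird : ∀ a b : Fin n, ∃ c, c ≠ a ∧ c ≠ b := fun a b ↦ by
    have hcard : ({a, b} : Finset (Fin n)).card < Fintype.card (Fin n) := by
      have := Finset.card_le_two (a := a) (b := b)
      rw [Fintype.card_fin]
      omega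
    obtain ⟨c, hc⟩ := Finset.exists_mem_notMem_of_card_lt_card hcard
    exact ⟨c, by simpa using hc⟩
  have hA : ∀ j l, A j l = 0 := eq_zero_of_koszul_symm A hthird
    (fun j l ↦ by simp only [A, fun r ↦ hsym2 r r j l])
    (fun k i j l ↦ (hkoszul k i j l).symm.trans ((hsym2 k i j l).trans (hkoszul k i l j)))
  funext k i j l
  simpa [hA] using hkoszul k i j l
end
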